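/- arXiv:2008.01036 — 3 statements merged into one kernel-verified Lean document; each statement's English description precedes it below -/
import Mathlib

section
/- Let n ≥ d+1, let B ∈ ℝ^{d×n}, b ∈ ℝ^n, x ∈ ℝ^d and a ∈ ℝ, and let B' ∈ ℝ^{(d+1)×n} be the matrix obtained from B by appending bᵀ as a new last row. If B' has linearly independent rows (hence so does B), then ‖B'⁺ [x; a]‖² ≥ ‖B⁺ x‖², where [x; a] ∈ ℝ^{d+1} is x with the entry a appended. -/
open Matrix

noncomputable section

/-- Squared Euclidean norm of a vector in `ℝ^n`. -/
def sqnorm {n : ℕ} (v : Fin n → ℝ) : ℝ := ∑ i, v i ^ 2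

/-- Moore–Penrose pseudoinverse of a matrix with linearly independent rows:
`M⁺ = Mᵀ (M Mᵀ)⁻¹`. -/
def pinvRows {m n : ℕ} (M : Matrix (Fin m) (Fin n) ℝ) : Matrix (Fin n) (Fin m) ℝ :=
  Mᵀ * (M * Mᵀ)⁻¹

/-- Append a row at the bottom of a matrix. -/
def appendRow {m n : ℕ} (M : Matrix (Fin m) (Fin n) ℝ) (r : Fin n → ℝ) :
    Matrix (Fin (m + 1)) (Fin n) ℝ := Matrix.of (Fin.snoc (fun i => M i) r)

theorem isUnit_mul_transpose {m n : ℕ} {M : Matrix (Fin m) (Fin n) ℝ}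
    (hM : LinearIndependent ℝ M.row) : IsUnit (M * Mᵀ) := by
  have hpos : (M * Mᴴ).PosDef :=
    Matrix.PosDef.mul_conjTranspose_self M (Matrix.vecMul_injective_iff.mpr hM)
  simpa only [Matrix.conjTranspose_eq_transpose_of_trivial] using hpos.isUnit

theorem mulVec_pinvRows_mulVec {m n : ℕ} {M : Matrix (Fin m) (Fin n) ℝ}
    (hM : LinearIndependent ℝ M.row) (y : Fin m → ℝ) : M *ᵥ (pinvRows M *ᵥ y) = y := by
  have hdet := (Matrix.isUnit_iff_isUnit_det _).mp (isUnit_mul_transpose hM)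
  rw [Matrix.mulVec_mulVec, pinvRows, ← Matrix.mul_assoc, Matrix.mul_nonsing_inv _ hdet,
    Matrix.one_mulVec]

theorem sqnorm_eq_dotProduct {n : ℕ} (v : Fin n → ℝ) : sqnorm v = v ⬝ᵥ v := by
  simp only [sqnorm, dotProduct, sq]

theorem sqnorm_nonneg {n : ℕ} (v : Fin n → ℝ) : 0 ≤ sqnorm v :=
  Finset.sum_nonneg fun _ _ => sq_nonneg _

/-- `M⁺y` has the least norm among the solutions `z` of `M z = y`. -/
theorem sqnorm_pinvRows_mulVec_le {m n : ℕ} {M : Matrix (Fin m) (Fin n) ℝ}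
    (hM : LinearIndependent ℝ M.row) (z : Fin n → ℝ) :
    sqnorm (pinvRows M *ᵥ (M *ᵥ z)) ≤ sqnorm z := by
  set w := pinvRows M *ᵥ (M *ᵥ z) with hw
  have hMw : M *ᵥ (z - w) = 0 := by
    rw [Matrix.mulVec_sub, hw, mulVec_pinvRows_mulVec hM, sub_self]
  have horth : w ⬝ᵥ (z - w) = 0 := by
    have hwM : w = ((M * Mᵀ)⁻¹ *ᵥ (M *ᵥ z)) ᵥ* M := by
      rw [hw, pinvRows, ← Matrix.mulVec_mulVec, Matrix.mulVec_transpose]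
    nth_rewrite 1 [hwM]
    rw [← Matrix.dotProduct_mulVec, hMw, dotProduct_zero]
  have hsplit : sqnorm z = sqnorm w + sqnorm (z - w) := by
    have hzw : z ⬝ᵥ w = w ⬝ᵥ z := dotProduct_comm z w
    simp only [sqnorm_eq_dotProduct, sub_dotProduct, dotProduct_sub] at horth ⊢
    linarith
  linarith [sqnorm_nonneg (z - w)]

theorem appendRow_castSucc {m n : ℕ} (M : Matrix (Fin m) (Fin n) ℝ) (r : Fin n → ℝ) (i : Fin m) :
    appendRow M r i.castSucc = M i :=
  Fin.snoc_castSucc (α := fun _ => Fin n → ℝ) r (fun i => M i) i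

/-- appending a row `bᵀ` to a full-row-rank wide matrix `B` and an entry `a` to `x`
can only increase `‖B⁺x‖²`. -/
theorem stmt0 (d n : ℕ) (hn : d + 1 ≤ n)
    (B : Matrix (Fin d) (Fin n) ℝ) (b : Fin n → ℝ) (x : Fin d → ℝ) (a : ℝ)
    (hli : LinearIndependent ℝ (fun i => appendRow B b i)) :
    sqnorm (pinvRows B *ᵥ x) ≤ sqnorm (pinvRows (appendRow B b) *ᵥ Fin.snoc x a) := by
  have hB : LinearIndependent ℝ B.row := by
    have h := hli.comp Fin.castSucc (Fin.castSucc_injective d)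
    simp only [Function.comp_def, appendRow_castSucc] at h
    exact h
  set z := pinvRows (appendRow B b) *ᵥ Fin.snoc x a with hz
  have hBz : B *ᵥ z = x := by
    funext i
    have h := congrFun (mulVec_pinvRows_mulVec (M := appendRow B b) hli (Fin.snoc x a)) i.castSucc
    rw [← hz, Fin.snoc_castSucc (α := fun _ => ℝ)] at h
    rw [← h, Matrix.mulVec, Matrix.mulVec, appendRow_castSucc]
  simpa only [hBz] using sqnorm_pinvRows_mulVec_le hB z

end
end

section
/- Let A ∈ ℝ^{n×d} and 0 ≠ b ∈ ℝ^n with n ≥ d+1. Set P = AA⁺, Q = bbᵀ/‖b‖², and z = bᵀ(I−P)b/‖b‖². If z ≠ 0 and the columnwise partitioned matrix [A, b] has linearly independent columns, then the Moore–Penrose pseudoinverse of the (d+1)×n matrix [Aᵀ; bᵀ] (Aᵀ with bᵀ appended as a last row) equals the n×(d+1) block matrix [ (I − Q)(I + PQ/z)(A⁺)ᵀ , (I−P)b / (bᵀ(I−P)b) ], whose first d columns are (I − Q)(I + PQ/z)(A⁺)ᵀ and whose last column is (I−P)b / (bᵀ(I−P)b). Moreover z = 1 − tr(PQ). -/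
open Matrix

noncomputable section

/-- Moore–Penrose pseudoinverse of a matrix with linearly independent columns:
`M⁺ = (Mᵀ M)⁻¹ Mᵀ`. -/
def pinvCols {m n : ℕ} (M : Matrix (Fin m) (Fin n) ℝ) : Matrix (Fin n) (Fin m) ℝ :=
  (Mᵀ * M)⁻¹ * Mᵀ

/-- Append a column at the right of a matrix. -/
def appendCol {m n : ℕ} (M : Matrix (Fin m) (Fin n) ℝ) (c : Fin m → ℝ) :
    Matrix (Fin m) (Fin (n + 1)) ℝ := Matrix.of (fun i => Fin.snoc (M i) (c i))

theorem appendRow_mul {m n k : ℕ} (M : Matrix (Fin m) (Fin n) ℝ) (r : Fin n → ℝ)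
    (X : Matrix (Fin n) (Fin k) ℝ) :
    appendRow M r * X = appendRow (M * X) (r ᵥ* X) := by
  ext i j
  refine Fin.lastCases ?_ (fun i => ?_) i <;>
    simp [appendRow, Matrix.mul_apply, vecMul, dotProduct]

theorem mul_appendCol {m n k : ℕ} (M : Matrix (Fin m) (Fin n) ℝ)
    (X : Matrix (Fin n) (Fin k) ℝ) (c : Fin n → ℝ) :
    M * appendCol X c = appendCol (M * X) (M *ᵥ c) := by
  ext i j
  refine Fin.lastCases ?_ (fun j => ?_) j <;>
    simp [appendCol, Matrix.mul_apply, mulVec, dotProduct]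

theorem appendCol_mul_appendRow {m n k : ℕ} (A : Matrix (Fin m) (Fin n) ℝ) (b : Fin m → ℝ)
    (U : Matrix (Fin n) (Fin k) ℝ) (u : Fin k → ℝ) :
    appendCol A b * appendRow U u = A * U + vecMulVec b u := by
  ext i j
  simp [appendCol, appendRow, Matrix.mul_apply, Fin.sum_univ_castSucc, vecMulVec_apply]

theorem transpose_appendRow {m n : ℕ} (M : Matrix (Fin m) (Fin n) ℝ) (r : Fin n → ℝ) :
    (appendRow M r)ᵀ = appendCol Mᵀ r := by
  ext i j
  refine Fin.lastCases ?_ (fun j => ?_) j <;> simp [appendCol, appendRow]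

theorem appendCol_add_vecMulVec_snoc {m n : ℕ} (X : Matrix (Fin m) (Fin n) ℝ)
    (x b : Fin m → ℝ) (u : Fin n → ℝ) (c : ℝ) :
    appendCol X x + vecMulVec b (Fin.snoc u c : Fin (n + 1) → ℝ) =
      appendCol (X + vecMulVec b u) (x + c • b) := by
  ext i j
  refine Fin.lastCases ?_ (fun j => ?_) j <;>
    simp [appendCol, vecMulVec_apply, mul_comm]

theorem appendRow_appendCol_eq_one {n : ℕ} :
    appendRow (appendCol (1 : Matrix (Fin n) (Fin n) ℝ) 0) (Fin.snoc 0 1) = 1 := by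
  ext i j
  refine Fin.lastCases ?_ (fun i => ?_) i <;> refine Fin.lastCases ?_ (fun j => ?_) j <;>
    simp [appendCol, appendRow, Matrix.one_apply, Fin.castSucc_ne_last,
      (Fin.castSucc_ne_last _).symm]

theorem vecMul_appendCol {m n : ℕ} (r : Fin m → ℝ) (X : Matrix (Fin m) (Fin n) ℝ)
    (c : Fin m → ℝ) :
    r ᵥ* appendCol X c = (Fin.snoc (r ᵥ* X) (r ⬝ᵥ c) : Fin (n + 1) → ℝ) := by
  ext j
  refine Fin.lastCases ?_ (fun j => ?_) j <;> simp [appendCol, vecMul, dotProduct]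

/-- A right inverse of `M` whose columns lie in the row space of `M` is the pseudoinverse. -/
theorem pinvRows_eq_of_mul_eq_one {m n : ℕ} {M : Matrix (Fin m) (Fin n) ℝ}
    {X : Matrix (Fin n) (Fin m) ℝ} (Y : Matrix (Fin m) (Fin m) ℝ)
    (hX : Mᵀ * Y = X) (h : M * X = 1) : pinvRows M = X := by
  have hY : (M * Mᵀ)⁻¹ = Y := Matrix.inv_eq_right_inv (by rw [Matrix.mul_assoc, hX, h])
  rw [pinvRows, hY, hX]

theorem isUnit_det_transpose_mul_self {m n : ℕ} {A : Matrix (Fin m) (Fin n) ℝ}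
    (h : LinearIndependent ℝ A.col) : IsUnit (Aᵀ * A).det := by
  have := Matrix.PosDef.conjTranspose_mul_self A (Matrix.mulVec_injective_iff.mpr h)
  rw [Matrix.conjTranspose_eq_transpose_of_trivial] at this
  exact this.det_pos.ne'.isUnit

/-- explicit formula for the pseudoinverse of `[Aᵀ; bᵀ]` (Lemma 2 of the paper),
together with `z = 1 - tr(PQ)`. -/
theorem stmt3 (n d : ℕ) (hn : d + 1 ≤ n)
    (A : Matrix (Fin n) (Fin d) ℝ) (b : Fin n → ℝ) (hb : b ≠ 0)
    (P Q : Matrix (Fin n) (Fin n) ℝ) (z : ℝ)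
    (hP : P = A * pinvCols A)
    (hQ : Q = (sqnorm b)⁻¹ • vecMulVec b b)
    (hz : z = (b ⬝ᵥ ((1 - P) *ᵥ b)) / sqnorm b)
    (hz0 : z ≠ 0)
    (hli : LinearIndependent ℝ (fun j => (appendCol A b)ᵀ j)) :
    pinvRows (appendRow Aᵀ b) =
      appendCol ((1 - Q) * (1 + z⁻¹ • (P * Q)) * (pinvCols A)ᵀ)
        ((b ⬝ᵥ ((1 - P) *ᵥ b))⁻¹ • ((1 - P) *ᵥ b)) ∧
    z = 1 - (P * Q).trace := by
  have hA : LinearIndependent ℝ A.col := by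
    have h := hli.comp Fin.castSucc (Fin.castSucc_injective d)
    convert h using 1
    ext j i
    simp [appendCol, Matrix.col]
  have hdet := isUnit_det_transpose_mul_self hA
  have hs : sqnorm b ≠ 0 := by
    rw [sqnorm_eq_dotProduct]
    exact fun h => hb (dotProduct_self_eq_zero.mp h)
  have hsb : b ⬝ᵥ b = sqnorm b := (sqnorm_eq_dotProduct b).symm
  have hw : b ⬝ᵥ ((1 - P) *ᵥ b) = z * sqnorm b := by rw [hz]; field_simp
  have hPb : b ⬝ᵥ (P *ᵥ b) = (1 - z) * sqnorm b := by
    rw [Matrix.sub_mulVec, Matrix.one_mulVec, dotProduct_sub, hsb] at hw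
    linarith
  set G := (Aᵀ * A)⁻¹ with hG
  have hGt : Gᵀ = G := by
    rw [hG, Matrix.transpose_nonsing_inv, Matrix.transpose_mul, Matrix.transpose_transpose]
  have hC : (pinvCols A)ᵀ = A * G := by
    rw [pinvCols, Matrix.transpose_mul, Matrix.transpose_transpose, ← hG, hGt]
  have hPG : P = A * (G * Aᵀ) := hP
  have hAC : Aᵀ * (A * G) = 1 := by
    rw [← Matrix.mul_assoc, hG, Matrix.mul_nonsing_inv _ hdet]
  have hAP : Aᵀ * (1 - P) = 0 := by
    rw [Matrix.mul_sub, Matrix.mul_one, hPG, ← Matrix.mul_assoc A, ← Matrix.mul_assoc Aᵀ, hAC,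
      Matrix.one_mul, sub_self]
  have hQPQ : Q * (P * Q) = (1 - z) • Q := by
    rw [hQ, Matrix.mul_smul, Matrix.mul_smul, Matrix.smul_mul, Matrix.mul_vecMulVec,
      Matrix.vecMulVec_mul_vecMulVec, hPb, Matrix.vecMulVec_smul, smul_smul, smul_smul, smul_smul]
    congr 1
    field_simp
  have hF : (1 - Q) * (1 + z⁻¹ • (P * Q)) = 1 - z⁻¹ • ((1 - P) * Q) := by
    have hcoef : z⁻¹ * (1 - z) = z⁻¹ - 1 := by field_simp
    rw [Matrix.sub_mul, Matrix.mul_add Q, Matrix.mul_smul, hQPQ, smul_smul, hcoef, Matrix.sub_mul,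
      sub_smul, smul_sub]
    simp only [Matrix.one_mul, Matrix.mul_one, one_smul]
    abel
  have hbQ : b ᵥ* (1 - Q) = 0 := by
    rw [Matrix.vecMul_sub, Matrix.vecMul_one, hQ, Matrix.vecMul_smul, Matrix.vecMul_vecMulVec,
      hsb, smul_smul, inv_mul_cancel₀ hs, one_smul, sub_self]
  refine ⟨?_, ?_⟩
  · refine pinvRows_eq_of_mul_eq_one
      (appendRow
        (appendCol (G + z⁻¹ • (G * Aᵀ * (Q * (A * G)))) (-(z * sqnorm b)⁻¹ • ((G * Aᵀ) *ᵥ b)))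
        (Fin.snoc (-(z⁻¹ * (sqnorm b)⁻¹) • (b ᵥ* (A * G))) (z * sqnorm b)⁻¹)) ?_ ?_
    · rw [transpose_appendRow, Matrix.transpose_transpose, appendCol_mul_appendRow,
        mul_appendCol, appendCol_add_vecMulVec_snoc, hw, hF, hC]
      congr 1
      · have hQC : Q * (A * G) = (sqnorm b)⁻¹ • vecMulVec b (b ᵥ* (A * G)) := by
          rw [hQ, Matrix.smul_mul, Matrix.vecMulVec_mul]
        rw [Matrix.vecMulVec_smul, neg_smul, mul_smul, ← hQC, Matrix.mul_add, Matrix.mul_smul,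
          ← Matrix.mul_assoc A (G * Aᵀ), ← hPG, Matrix.sub_mul, Matrix.smul_mul,
          Matrix.mul_assoc (1 - P), Matrix.sub_mul 1 P, smul_sub]
        simp only [Matrix.one_mul]
        abel
      · rw [Matrix.mulVec_smul, Matrix.mulVec_mulVec, ← hPG, Matrix.sub_mulVec,
          Matrix.one_mulVec, smul_sub, neg_smul]
        abel
    · rw [appendRow_mul, mul_appendCol, vecMul_appendCol, ← appendRow_appendCol_eq_one]
      congr 2
      · rw [hF, hC, ← Matrix.mul_assoc Aᵀ, Matrix.mul_sub, Matrix.mul_smul,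
          ← Matrix.mul_assoc Aᵀ (1 - P), hAP, Matrix.zero_mul, smul_zero, sub_zero, Matrix.mul_one, hAC]
      · rw [Matrix.mulVec_smul, Matrix.mulVec_mulVec, hAP, Matrix.zero_mulVec, smul_zero]
      · rw [Matrix.mul_assoc, ← Matrix.vecMul_vecMul, hbQ, Matrix.zero_vecMul]
      · rw [dotProduct_smul, hw, smul_eq_mul, inv_mul_cancel₀ (mul_ne_zero hz0 hs)]
  · rw [hQ, Matrix.mul_smul, Matrix.trace_smul, Matrix.mul_vecMulVec, Matrix.trace_vecMulVec,
      dotProduct_comm, hPb, smul_eq_mul]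
    field_simp
    ring

end
end

section
/- Let k ≥ 1, let Z₁,…,Z_k be i.i.d. standard Gaussian N(0,1) random variables, and let μ₁,…,μ_k ∈ ℝ with Σᵢ μᵢ² > 0. Then for every c > 0, P( Σᵢ (Zᵢ + μᵢ)² ≥ c ) > P( Σᵢ Zᵢ² ≥ c ). In other words, a noncentral chi-squared random variable with k degrees of freedom and noncentrality parameter λ = Σᵢ μᵢ² > 0 strictly first-order stochastically dominates a central chi-squared random variable with k degrees of freedom. -/
open MeasureTheory ProbabilityTheory

noncomputable section

open scoped ENNReal

/-- Among the sets of a given `ν.withDensity g`-measure, a sublevel set of `g` has the largest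
`ν`-measure. -/
theorem measure_lt_of_withDensity_eq {α : Type*} [MeasurableSpace α] {ν : Measure α}
    [IsFiniteMeasure ν] {g : α → ℝ≥0∞} {A B : Set α} (hA : MeasurableSet A)
    (hB : MeasurableSet B) {κ : ℝ≥0∞} (hκ : κ ≠ ∞) (hgB : ∀ x ∈ B, g x < κ)
    (hgBc : ∀ x ∉ B, κ ≤ g x) (heq : ν.withDensity g A = ν.withDensity g B)
    (hpos : ν.withDensity g (B \ A) ≠ 0) : ν A < ν B := by
  have hfin : ν.withDensity g B ≠ ∞ := by
    rw [withDensity_apply _ hB]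
    refine ne_top_of_le_ne_top (ENNReal.mul_ne_top hκ (measure_ne_top ν B)) ?_
    rw [← setLIntegral_const]
    exact setLIntegral_mono measurable_const fun x hx => (hgB x hx).le
  have hsdiff : ν.withDensity g (A \ B) = ν.withDensity g (B \ A) := by
    have h₁ := measure_sdiff_add_inter (μ := ν.withDensity g) A hB
    have h₂ := measure_sdiff_add_inter (μ := ν.withDensity g) B hA
    rw [heq, ← h₂, Set.inter_comm B A] at h₁
    exact (ENNReal.add_left_inj
      (ne_top_of_le_ne_top hfin (measure_mono Set.inter_subset_right))).1 h₁
  have hν : ν (B \ A) ≠ 0 := fun h => hpos (withDensity_absolutelyContinuous ν g h)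
  have hlow : κ * ν (A \ B) ≤ ν.withDensity g (A \ B) := by
    rw [withDensity_apply _ (hA.diff hB), ← setLIntegral_const]
    exact setLIntegral_mono' (hA.diff hB) fun x hx => hgBc x hx.2
  have hup : ν.withDensity g (B \ A) < κ * ν (B \ A) := by
    have hfin' := ne_top_of_le_ne_top hfin (measure_mono (Set.sdiff_subset (t := A)))
    rw [withDensity_apply _ (hB.diff hA)] at hfin' ⊢
    rw [← setLIntegral_const]
    exact setLIntegral_strict_mono (hB.diff hA) hν measurable_const hfin'
      (ae_of_all _ fun x hx => hgB x hx.1)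
  have hlt : ν (A \ B) < ν (B \ A) := lt_of_mul_lt_mul_left' ((hlow.trans_eq hsdiff).trans_lt hup)
  rw [← measure_sdiff_add_inter A hB, ← measure_sdiff_add_inter B hA, Set.inter_comm B A]
  exact ENNReal.add_lt_add_right (measure_ne_top _ _) hlt

theorem pi_withDensity {ι : Type*} [Fintype ι] {Ω : ι → Type*} [∀ i, MeasurableSpace (Ω i)]
    (ν : ∀ i, Measure (Ω i)) [∀ i, IsProbabilityMeasure (ν i)] {g : ∀ i, Ω i → ℝ≥0∞}
    (hg : ∀ i, Measurable (g i)) [∀ i, SigmaFinite ((ν i).withDensity (g i))] :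
    Measure.pi (fun i => (ν i).withDensity (g i)) =
      (Measure.pi ν).withDensity fun x => ∏ i, g i (x i) := by
  classical
  refine Measure.pi_eq fun s hs => ?_
  have hind : ∀ i, Measurable ((s i).indicator (g i)) := fun i => (hg i).indicator (hs i)
  rw [withDensity_apply _ (MeasurableSet.univ_pi hs),
    ← lintegral_indicator (MeasurableSet.univ_pi hs)]
  have hprod : ∀ x : ∀ i, Ω i, (Set.univ.pi s).indicator (fun x => ∏ i, g i (x i)) x =
      ∏ i, (s i).indicator (g i) (x i) := by
    intro x
    by_cases hx : x ∈ Set.univ.pi s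
    · rw [Set.indicator_of_mem hx]
      exact Finset.prod_congr rfl fun i _ => (Set.indicator_of_mem (hx i trivial) _).symm
    · rw [Set.indicator_of_notMem hx]
      obtain ⟨i, hi⟩ : ∃ i, x i ∉ s i := by simpa [Set.mem_pi] using hx
      exact (Finset.prod_eq_zero (Finset.mem_univ i) (Set.indicator_of_notMem hi _)).symm
  simp_rw [hprod]
  rw [lintegral_prod_eq_prod_lintegral_of_indepFun Finset.univ
    (fun i (x : ∀ i, Ω i) => (s i).indicator (g i) (x i))
    (iIndepFun_pi fun i => (hind i).aemeasurable) fun i => (hind i).comp (measurable_pi_apply i)]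
  refine Finset.prod_congr rfl fun i _ => ?_
  rw [(measurePreserving_eval ν i).lintegral_comp (hind i), lintegral_indicator (hs i),
    withDensity_apply _ (hs i)]

theorem gaussianReal_withDensity_exp :
    (gaussianReal 0 1).withDensity
      (fun x => ENNReal.ofReal (√(2 * Real.pi) * Real.exp (x ^ 2 / 2))) = volume := by
  rw [gaussianReal_of_var_ne_zero _ one_ne_zero]
  convert withDensity_inv_same (measurable_gaussianPDF 0 1)
    (ae_of_all volume fun x => (gaussianPDF_pos 0 one_ne_zero x).ne')
    (ae_of_all volume fun x => gaussianPDF_ne_top) using 3 with x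
  rw [gaussianPDF, ← ENNReal.ofReal_inv_of_pos (gaussianPDFReal_pos 0 1 x one_ne_zero),
    gaussianPDFReal, mul_inv, inv_inv, ← Real.exp_neg]
  simp [neg_div]

theorem pi_gaussianReal_withDensity_exp (ι : Type*) [Fintype ι] :
    (Measure.pi fun _ : ι => gaussianReal 0 1).withDensity
      (fun x => ENNReal.ofReal
        (√(2 * Real.pi) ^ Fintype.card ι * Real.exp ((∑ i, x i ^ 2) / 2))) = volume := by
  have : SigmaFinite ((gaussianReal 0 1).withDensity
      (fun x => ENNReal.ofReal (√(2 * Real.pi) * Real.exp (x ^ 2 / 2)))) := by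
    rw [gaussianReal_withDensity_exp]
    infer_instance
  have h := pi_withDensity (ι := ι) (fun _ => gaussianReal 0 1)
    (g := fun _ x => ENNReal.ofReal (√(2 * Real.pi) * Real.exp (x ^ 2 / 2)))
    (fun _ => by fun_prop)
  simp_rw [gaussianReal_withDensity_exp] at h
  rw [volume_pi, h]
  congr 1 with x
  rw [← ENNReal.ofReal_prod_of_nonneg fun i _ => by positivity, Finset.prod_mul_distrib,
    Finset.prod_const, ← Real.exp_sum, Finset.sum_div, Finset.card_univ]

theorem exists_sum_sq_lt_lt_sum_add_sq {ι : Type*} [Fintype ι] {μ : ι → ℝ}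
    (hμ : 0 < ∑ i, μ i ^ 2) {c : ℝ} (hc : 0 < c) :
    ∃ x : ι → ℝ, ∑ i, x i ^ 2 < c ∧ c < ∑ i, (x i + μ i) ^ 2 := by
  set l := ∑ i, μ i ^ 2
  set s := √(c / l)
  have hs : 0 < s := Real.sqrt_pos.2 (div_pos hc hμ)
  have hsl : s ^ 2 * l = c := by
    rw [Real.sq_sqrt (div_pos hc hμ).le, div_mul_cancel₀ _ hμ.ne']
  set t := s ^ 2 / (s + 1)
  have ht : 0 < t := by positivity
  have hts : t < s := by
    rw [div_lt_iff₀ (by positivity)]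
    nlinarith
  have hst : s < t + 1 := by
    rw [← sub_lt_iff_lt_add, lt_div_iff₀ (by positivity)]
    nlinarith
  refine ⟨fun i => t * μ i, ?_, ?_⟩
  · simp_rw [mul_pow]
    rw [← Finset.mul_sum, ← hsl]
    exact mul_lt_mul_of_pos_right (by gcongr) hμ
  · have : ∀ i, (t * μ i + μ i) ^ 2 = (t + 1) ^ 2 * μ i ^ 2 := fun i => by ring
    simp_rw [this]
    rw [← Finset.mul_sum, ← hsl]
    exact mul_lt_mul_of_pos_right (by gcongr) hμ

/-- a noncentral chi-squared variable strictly first-order stochastically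
dominates a central chi-squared variable with the same number of degrees of freedom. -/
theorem stmt9 (k : ℕ) (hk : 1 ≤ k) (μ : Fin k → ℝ) (hμ : 0 < ∑ i, μ i ^ 2)
    (c : ℝ) (hc : 0 < c) :
    (Measure.pi fun _ : Fin k => gaussianReal 0 1) {ω | c ≤ ∑ i, ω i ^ 2}
      < (Measure.pi fun _ : Fin k => gaussianReal 0 1) {ω | c ≤ ∑ i, (ω i + μ i) ^ 2} := by
  set ν := Measure.pi fun _ : Fin k => gaussianReal 0 1
  set A : Set (Fin k → ℝ) := {ω | ∑ i, (ω i + μ i) ^ 2 < c}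
  set B : Set (Fin k → ℝ) := {ω | ∑ i, ω i ^ 2 < c}
  have hA : MeasurableSet A := measurableSet_lt (by fun_prop) measurable_const
  have hB : MeasurableSet B := measurableSet_lt (by fun_prop) measurable_const
  have hAc : {ω : Fin k → ℝ | c ≤ ∑ i, (ω i + μ i) ^ 2} = Aᶜ := by ext; simp [A]
  have hBc : {ω : Fin k → ℝ | c ≤ ∑ i, ω i ^ 2} = Bᶜ := by ext; simp [B]
  have hdens := pi_gaussianReal_withDensity_exp (Fin k)
  have hC : 0 < √(2 * Real.pi) ^ Fintype.card (Fin k) := by positivity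
  have hlt : ν A < ν B := by
    refine measure_lt_of_withDensity_eq hA hB
      (κ := ENNReal.ofReal (√(2 * Real.pi) ^ Fintype.card (Fin k) * Real.exp (c / 2)))
      ENNReal.ofReal_ne_top (fun x hx => ?_) (fun x hx => ?_) ?_ ?_
      (g := fun x => ENNReal.ofReal
        (√(2 * Real.pi) ^ Fintype.card (Fin k) * Real.exp ((∑ i, x i ^ 2) / 2)))
    · rw [ENNReal.ofReal_lt_ofReal_iff (by positivity)]
      have hx : ∑ i, x i ^ 2 < c := hx
      gcongr
    · have hx : c ≤ ∑ i, x i ^ 2 := not_lt.1 hx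
      gcongr
    · rw [hdens]
      exact measure_preimage_add_right volume μ B
    · rw [hdens]
      obtain ⟨x, hxc, hcx⟩ := exists_sum_sq_lt_lt_sum_add_sq hμ hc
      have hopen : IsOpen (B ∩ {ω | c < ∑ i, (ω i + μ i) ^ 2}) :=
        (isOpen_lt (by fun_prop) continuous_const).inter (isOpen_lt continuous_const (by fun_prop))
      have hsub : B ∩ {ω | c < ∑ i, (ω i + μ i) ^ 2} ⊆ B \ A :=
        fun ω hω => ⟨hω.1, fun hωA : _ < c => lt_asymm hωA hω.2⟩
      exact ((hopen.measure_pos volume ⟨x, hxc, hcx⟩).trans_le (measure_mono hsub)).ne'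
  rw [hAc, hBc, prob_compl_eq_one_sub hA, prob_compl_eq_one_sub hB]
  exact (ENNReal.cancel_of_ne
    (ENNReal.sub_ne_top ENNReal.one_ne_top)).tsub_lt_tsub_left_of_le prob_le_one hlt

end
end
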